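/- arXiv:2501.16895 — 2 statements merged into one kernel-verified Lean document; each statement's English description precedes it below -/
import Mathlib

section
/- Let f : ℝⁿ → ℝᵐ be p times continuously differentiable, let x, v ∈ ℝⁿ, and let p be a natural number. Then the p-th order directional derivative of f at x along v equals the p-th derivative at t = 0 of the one-variable curve t ↦ f(x + t·v); that is, D^p f(x)[v, …, v] (the p-th Fréchet derivative of f at x applied to p copies of v) equals the p-th derivative of the function t ↦ f(x + t·v) evaluated at t = 0. -/
/-- Along a line `t ↦ x + t • v`, the iterated derivative of `f` is the iterated Fréchet derivative
evaluated on copies of `v`. -/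
theorem ContDiff.iteratedDeriv_comp_add_smul {𝕜 E F : Type*} [NontriviallyNormedField 𝕜]
    [NormedAddCommGroup E] [NormedSpace 𝕜 E] [NormedAddCommGroup F] [NormedSpace 𝕜 F]
    {f : E → F} {p : ℕ} (hf : ContDiff 𝕜 p f) (x v : E) (t : 𝕜) :
    iteratedDeriv p (fun s : 𝕜 => f (x + s • v)) t =
      iteratedFDeriv 𝕜 p f (x + t • v) (fun _ => v) := by
  have hg : ContDiff 𝕜 p (fun y => f (x + y)) := hf.comp (contDiff_const.add contDiff_id)
  have h := (ContinuousLinearMap.toSpanSingleton 𝕜 v).iteratedFDeriv_comp_right hg t le_rfl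
  rw [iteratedFDeriv_comp_add_left] at h
  simpa [iteratedDeriv_eq_iteratedFDeriv, Function.comp_def] using
    congrArg (fun M => M fun _ => (1 : 𝕜)) h

/-- The `p`-th order directional derivative of `f` at `x` along `v` equals the
`p`-th derivative at `t = 0` of the one-variable curve `t ↦ f (x + t • v)`. -/
theorem iteratedFDeriv_directional_eq_iteratedDeriv_curve
    {n m : ℕ} (f : EuclideanSpace ℝ (Fin n) → EuclideanSpace ℝ (Fin m))
    (p : ℕ) (hf : ContDiff ℝ p f)
    (x v : EuclideanSpace ℝ (Fin n)) :
    iteratedFDeriv ℝ p f x (fun _ => v) =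
      iteratedDeriv p (fun t : ℝ => f (x + t • v)) 0 := by
  simpa using (hf.iteratedDeriv_comp_add_smul x v 0).symm
end

section
/- Let p ≥ 1 be a natural number, let f : ℝ → ℝ be (p+1) times continuously differentiable, and let a ∈ ℝ be a simple root of f, i.e. f(a) = 0 and f'(a) ≠ 0. Then there exist δ > 0 and C ≥ 0 such that for every x with 0 < |x − a| < δ, we have f(x) ≠ 0, the p-th derivative (1/f)^{(p)}(x) of the reciprocal function y ↦ 1/f(y) is nonzero, and the Householder update G_p(x) = x + p · (1/f)^{(p−1)}(x) / (1/f)^{(p)}(x) satisfies |G_p(x) − a| ≤ C·|x − a|^{p+1}. -/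
open Filter Topology

/-- Differentiation under the integral sign along segments issuing from `a`. -/
theorem hasDerivAt_integral_pow_mul_comp_segment {φ : ℝ → ℝ} (hφ : ContDiff ℝ 1 φ) (a : ℝ) (k : ℕ)
    (x : ℝ) :
    HasDerivAt (fun x => ∫ t in (0 : ℝ)..1, t ^ k * φ (a + t * (x - a)))
      (∫ t in (0 : ℝ)..1, t ^ (k + 1) * deriv φ (a + t * (x - a))) x := by
  have hφ' : Continuous (deriv φ) := hφ.continuous_deriv le_rfl
  have hφc : Continuous φ := hφ.continuous
  have hcont : Continuous (fun z : ℝ × ℝ => z.2 ^ (k + 1) * deriv φ (a + z.2 * (z.1 - a))) := by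
    fun_prop
  obtain ⟨M, hM⟩ := ((isCompact_closedBall x 1).prod (isCompact_Icc (a := (0 : ℝ))
    (b := 1))).exists_bound_of_continuousOn hcont.continuousOn
  refine (intervalIntegral.hasDerivAt_integral_of_dominated_loc_of_deriv_le
    (F' := fun x t => t ^ (k + 1) * deriv φ (a + t * (x - a))) (bound := fun _ => M)
    (Metric.closedBall_mem_nhds x one_pos) ?_ ?_ ?_ ?_ ?_ ?_).2
  · exact Eventually.of_forall fun y => (by fun_prop : Continuous _).aestronglyMeasurable
  · exact (by fun_prop : Continuous _).intervalIntegrable _ _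
  · exact (by fun_prop : Continuous _).aestronglyMeasurable
  · refine Eventually.of_forall fun t ht y hy => hM (y, t) ⟨hy, ?_⟩
    rw [Set.uIoc_of_le zero_le_one] at ht
    exact ⟨ht.1.le, ht.2⟩
  · exact intervalIntegrable_const
  · refine Eventually.of_forall fun t _ y _ => ?_
    have h1 : HasDerivAt (fun y : ℝ => a + t * (y - a)) t y := by
      simpa using (((hasDerivAt_id y).sub_const a).const_mul t).const_add a
    have h2 := ((hφ.differentiable one_ne_zero _).hasDerivAt.comp y h1).const_mul (t ^ k)
    exact h2.congr_deriv (by ring)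

theorem contDiff_integral_pow_mul_comp_segment (n : ℕ) (a : ℝ) :
    ∀ {φ : ℝ → ℝ}, ContDiff ℝ n φ → ∀ k : ℕ,
      ContDiff ℝ n (fun x => ∫ t in (0 : ℝ)..1, t ^ k * φ (a + t * (x - a))) := by
  induction n with
  | zero =>
    intro φ hφ k
    have hφc : Continuous φ := hφ.continuous
    rw [Nat.cast_zero, contDiff_zero]
    exact intervalIntegral.continuous_parametric_intervalIntegral_of_continuous'
      (by fun_prop) _ _
  | succ n ih =>
    intro φ hφ k
    have hφ1 : ContDiff ℝ 1 φ := hφ.of_le (by exact_mod_cast Nat.le_add_left 1 n)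
    have hd := hasDerivAt_integral_pow_mul_comp_segment hφ1 a k
    rw [Nat.cast_add, Nat.cast_one, contDiff_succ_iff_deriv] at hφ ⊢
    refine ⟨fun x => (hd x).differentiableAt, by simp, ?_⟩
    rw [funext fun x => (hd x).deriv]
    exact ih hφ.2.2 (k + 1)

/-- **Hadamard's lemma** in one variable, with the sharp loss of one derivative. -/
theorem ContDiff.exists_eq_sub_mul {n : ℕ} {f : ℝ → ℝ} (hf : ContDiff ℝ (n + 1 : ℕ) f) {a : ℝ}
    (ha : f a = 0) :
    ∃ g : ℝ → ℝ, ContDiff ℝ n g ∧ g a = deriv f a ∧ ∀ x, f x = (x - a) * g x := by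
  have hf1 : ContDiff ℝ 1 f := hf.of_le (by exact_mod_cast Nat.le_add_left 1 n)
  have hf' : Continuous (deriv f) := hf1.continuous_deriv le_rfl
  rw [Nat.cast_add, Nat.cast_one, contDiff_succ_iff_deriv] at hf
  refine ⟨_, contDiff_integral_pow_mul_comp_segment n a hf.2.2 0, by simp, fun x => ?_⟩
  have hd : ∀ t : ℝ, HasDerivAt (fun t : ℝ => f (a + t * (x - a)))
      (deriv f (a + t * (x - a)) * (x - a)) t := fun t => by
    have h1 : HasDerivAt (fun t : ℝ => a + t * (x - a)) (x - a) t := by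
      simpa using ((hasDerivAt_id t).mul_const (x - a)).const_add a
    exact (hf1.differentiable one_ne_zero _).hasDerivAt.comp t h1
  have h := intervalIntegral.integral_eq_sub_of_hasDerivAt (a := 0) (b := 1) (fun t _ => hd t)
    ((by fun_prop : Continuous _).intervalIntegrable _ _)
  rw [intervalIntegral.integral_mul_const] at h
  simp only [pow_zero, one_mul, zero_mul, add_zero, ha, sub_zero, add_sub_cancel] at h ⊢
  rw [← h, mul_comm]

theorem iteratedDeriv_succ_sub_mul {n : ℕ} {q : ℝ → ℝ} {x : ℝ} (a : ℝ)
    (hq : ContDiffAt ℝ (n + 1 : ℕ) q x) :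
    iteratedDeriv (n + 1) (fun y => (y - a) * q y) x =
      (x - a) * iteratedDeriv (n + 1) q x + (n + 1) * iteratedDeriv n q x := by
  have hu : ContDiffAt ℝ (n + 1 : ℕ) (fun y : ℝ => y - a) x := by fun_prop
  have h2 : ∀ i, iteratedDeriv (i + 2) (fun y : ℝ => y - a) x = 0 := fun i => by
    have h : deriv (fun y : ℝ => y - a) = fun _ => 1 := by ext; simp
    rw [iteratedDeriv_succ', h, iteratedDeriv_const]
    simp
  have h := iteratedDeriv_mul hu hq
  rw [Finset.sum_range_succ', Finset.sum_range_succ', Finset.sum_eq_zero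
    (fun i _ => by rw [h2]; simp)] at h
  simp only [Pi.mul_def] at h
  rw [h]
  simp
  ring

theorem ContDiffAt.continuousAt_iteratedDeriv {n : ℕ} {h : ℝ → ℝ} {a : ℝ}
    (hh : ContDiffAt ℝ n h a) : ContinuousAt (iteratedDeriv n h) a := by
  rw [iteratedDeriv_eq_equiv_comp]
  exact (LinearIsometryEquiv.continuous _).continuousAt.comp
    (hh.continuousAt_iteratedFDeriv le_rfl)

/-- If `h = (· - a) * q` on a punctured neighbourhood of `a`, the Leibniz rule links the iterated
derivatives of `h` and `q` there. -/
theorem eventually_iteratedDeriv_succ_eq {n : ℕ} {q h : ℝ → ℝ} {a : ℝ}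
    (hqh : ∀ᶠ x in 𝓝[≠] a, h x = (x - a) * q x)
    (hq : ∀ᶠ x in 𝓝[≠] a, ContDiffAt ℝ (n + 1 : ℕ) q x) :
    ∀ᶠ x in 𝓝[≠] a, iteratedDeriv (n + 1) h x =
      (x - a) * iteratedDeriv (n + 1) q x + (n + 1) * iteratedDeriv n q x := by
  filter_upwards [eventually_eventually_nhdsWithin.2 hqh, hq, self_mem_nhdsWithin]
    with x hx hqx hxa
  rw [isOpen_compl_singleton.nhdsWithin_eq hxa] at hx
  rw [← iteratedDeriv_succ_sub_mul a hqx]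
  exact Filter.EventuallyEq.iteratedDeriv_eq _ hx

theorem tendsto_pow_mul_iteratedDeriv {n : ℕ} {q h : ℝ → ℝ} {a : ℝ} (hh : ContDiffAt ℝ n h a)
    (hqh : ∀ᶠ x in 𝓝[≠] a, h x = (x - a) * q x) (hq : ∀ᶠ x in 𝓝[≠] a, ContDiffAt ℝ n q x) :
    Tendsto (fun x => (x - a) ^ (n + 1) * iteratedDeriv n q x) (𝓝[≠] a)
      (𝓝 ((-1) ^ n * n.factorial * h a)) := by
  induction n with
  | zero =>
    simp only [zero_add, pow_one, iteratedDeriv_zero, pow_zero, Nat.factorial_zero, Nat.cast_one,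
      one_mul]
    exact (hh.continuousAt.tendsto.mono_left nhdsWithin_le_nhds).congr' hqh
  | succ n ih =>
    have hle : ((n : ℕ) : WithTop ℕ∞) ≤ (n + 1 : ℕ) := by exact_mod_cast n.le_succ
    have h1 := ih (hh.of_le hle) (hq.mono fun x hx => hx.of_le hle)
    have hu : Tendsto (fun x : ℝ => (x - a) ^ (n + 1)) (𝓝[≠] a) (𝓝 0) := by
      have : ContinuousAt (fun x : ℝ => (x - a) ^ (n + 1)) a := by fun_prop
      simpa using this.tendsto.mono_left nhdsWithin_le_nhds
    have h2 := (hu.mul (hh.continuousAt_iteratedDeriv.tendsto.mono_left nhdsWithin_le_nhds)).sub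
      (h1.const_mul ((n : ℝ) + 1))
    have hlim : (-1 : ℝ) ^ (n + 1) * (n + 1).factorial * h a =
        0 * iteratedDeriv (n + 1) h a - ((n : ℝ) + 1) * ((-1) ^ n * n.factorial * h a) := by
      rw [Nat.factorial_succ]
      push_cast
      ring
    rw [hlim]
    refine h2.congr' ?_
    filter_upwards [eventually_iteratedDeriv_succ_eq hqh hq] with x hx
    rw [hx]
    ring

/-- Order-`(p+1)` local convergence of Householder's method of order `p`
at a simple root. -/
theorem householder_convergence_order (p : ℕ) (hp : 1 ≤ p)
    (f : ℝ → ℝ) (hf : ContDiff ℝ (p + 1 : ℕ) f)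
    (a : ℝ) (ha : f a = 0) (ha' : deriv f a ≠ 0) :
    ∃ δ > 0, ∃ C ≥ 0, ∀ x : ℝ, 0 < |x - a| → |x - a| < δ →
      f x ≠ 0 ∧
      iteratedDeriv p (fun y => 1 / f y) x ≠ 0 ∧
      |x + p * iteratedDeriv (p - 1) (fun y => 1 / f y) x /
          iteratedDeriv p (fun y => 1 / f y) x - a| ≤
        C * |x - a| ^ (p + 1) := by
  obtain ⟨m, rfl⟩ : ∃ m, p = m + 1 := ⟨p - 1, by omega⟩
  obtain ⟨g, hg, hga, hfg⟩ := hf.exists_eq_sub_mul ha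
  rw [← hga] at ha'
  set q : ℝ → ℝ := fun y => 1 / f y with hq_def
  set h : ℝ → ℝ := fun y => (g y)⁻¹ with hh_def
  have hh : ContDiffAt ℝ (m + 1 : ℕ) h a := hg.contDiffAt.inv ha'
  have hf0 : ∀ᶠ x in 𝓝[≠] a, f x ≠ 0 := by
    filter_upwards [(hg.continuous.continuousAt.eventually_ne ha').filter_mono nhdsWithin_le_nhds,
      self_mem_nhdsWithin] with x hx hxa
    rw [hfg]
    exact mul_ne_zero (sub_ne_zero.2 hxa) hx
  have hq : ∀ᶠ x in 𝓝[≠] a, ContDiffAt ℝ (m + 1 : ℕ) q x := by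
    filter_upwards [hf0] with x hx
    exact contDiffAt_const.div
      (hf.contDiffAt.of_le (by exact_mod_cast (m + 1).le_succ)) hx
  have hqh : ∀ᶠ x in 𝓝[≠] a, h x = (x - a) * q x := by
    filter_upwards [self_mem_nhdsWithin] with x hxa
    have : x - a ≠ 0 := sub_ne_zero.2 hxa
    simp only [hh_def, hq_def, hfg, one_div, mul_inv]
    rw [mul_inv_cancel_left₀ this]
  have hA := tendsto_pow_mul_iteratedDeriv hh hqh hq
  have hL : (-1 : ℝ) ^ (m + 1) * (m + 1).factorial * h a ≠ 0 :=
    mul_ne_zero (mul_ne_zero (pow_ne_zero _ (by norm_num)) (by positivity)) (inv_ne_zero ha')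
  have hB := ((hh.continuousAt_iteratedDeriv.tendsto.mono_left nhdsWithin_le_nhds).div hA hL).abs
  set L := |iteratedDeriv (m + 1) h a / ((-1 : ℝ) ^ (m + 1) * (m + 1).factorial * h a)|
  have key : ∀ᶠ x in 𝓝[≠] a, f x ≠ 0 ∧ iteratedDeriv (m + 1) q x ≠ 0 ∧
      |x + (m + 1 : ℕ) * iteratedDeriv (m + 1 - 1) q x / iteratedDeriv (m + 1) q x - a| ≤
        (L + 1) * |x - a| ^ (m + 1 + 1) := by
    filter_upwards [hf0, hA.eventually_ne hL, hB.eventually_le_const (lt_add_one L),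
      eventually_iteratedDeriv_succ_eq hqh hq, self_mem_nhdsWithin] with x hfx hAx hBx hx hxa
    have hq0 : iteratedDeriv (m + 1) q x ≠ 0 := right_ne_zero_of_mul hAx
    have hu : x - a ≠ 0 := sub_ne_zero.2 hxa
    refine ⟨hfx, hq0, ?_⟩
    have hG : x + (m + 1 : ℕ) * iteratedDeriv (m + 1 - 1) q x / iteratedDeriv (m + 1) q x - a =
        iteratedDeriv (m + 1) h x / ((x - a) ^ (m + 1 + 1) * iteratedDeriv (m + 1) q x) *
          (x - a) ^ (m + 1 + 1) := by
      rw [hx, Nat.add_sub_cancel]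
      push_cast
      field_simp
      ring
    rw [hG, abs_mul, abs_pow]
    gcongr
    exact hBx
  obtain ⟨δ, hδ, H⟩ := Metric.eventually_nhds_iff.1 (eventually_nhdsWithin_iff.1 key)
  exact ⟨δ, hδ, L + 1, by positivity, fun x hx0 hxδ =>
    H (by rwa [Real.dist_eq]) (sub_ne_zero.1 (abs_pos.1 hx0))⟩
end
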